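/- Euler relation: for an n-dimensional convex polytope P with f_j faces of dimension j, one has Σ_{j=0}^{n} (−1)^j f_j = 1 (equivalently, including the empty face f_{−1} = 1, the alternating sum Σ_{j=−1}^{n} (−1)^j f_j = 0). -/

import Mathlib

noncomputable section

abbrev Euc (n : ℕ) := EuclideanSpace ℝ (Fin n)

/-- A (compact) convex polytope: the convex hull of a nonempty finite set. -/
def IsPolytope {n : ℕ} (P : Set (Euc n)) : Prop :=
  ∃ s : Finset (Euc n), s.Nonempty ∧ P = convexHull ℝ (s : Set (Euc n))

/-- The dimension of a set: the dimension of its affine span. -/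
def faceDim {n : ℕ} (F : Set (Euc n)) : ℕ :=
  Module.finrank ℝ (affineSpan ℝ F).direction

/-- `F` is a (nonempty) `j`-dimensional face of `P`: an intersection of `P` with a
supporting hyperplane, or `P` itself, of dimension `j`. -/
def IsFaceDim {n : ℕ} (P F : Set (Euc n)) (j : ℕ) : Prop :=
  IsExposed ℝ P F ∧ F.Nonempty ∧ faceDim F = j

open Topology Filter

section Arr
variable {V : Type*} [AddCommGroup V] [Module ℝ V]

def flatSub {m : ℕ} (W : Submodule ℝ V) (a : Fin m → V →ₗ[ℝ] ℝ) (σ : Fin m → SignType) :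
    Submodule ℝ V where
  carrier := {x | x ∈ W ∧ ∀ i, σ i = 0 → a i x = 0}
  add_mem' := by
    rintro x y ⟨hx, hx'⟩ ⟨hy, hy'⟩
    exact ⟨W.add_mem hx hy, fun i hi => by simp [hx' i hi, hy' i hi]⟩
  zero_mem' := ⟨W.zero_mem, by simp⟩
  smul_mem' := by
    rintro c x ⟨hx, hx'⟩
    exact ⟨W.smul_mem c hx, fun i hi => by simp [hx' i hi]⟩

def cellSet {m : ℕ} (X : Set V) (a : Fin m → V →ₗ[ℝ] ℝ) (σ : Fin m → SignType) : Set V :=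
  {x | x ∈ X ∧ ∀ i, SignType.sign (a i x) = σ i}

open Classical in
def eul {m : ℕ} (X : Set V) (W : Submodule ℝ V) (a : Fin m → V →ₗ[ℝ] ℝ) : ℤ :=
  ∑ σ : Fin m → SignType,
    if (cellSet X a σ).Nonempty then (-1 : ℤ) ^ Module.finrank ℝ (flatSub W a σ) else 0

def cutSet (X : Set V) (b : V →ₗ[ℝ] ℝ) (ε : SignType) : Set V :=
  {x | x ∈ X ∧ SignType.sign (b x) = ε}

def cutSub (W : Submodule ℝ V) (b : V →ₗ[ℝ] ℝ) (ε : SignType) : Submodule ℝ V :=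
  if ε = 0 then W ⊓ LinearMap.ker b else W

lemma flat_cons {m : ℕ} (W : Submodule ℝ V) (a : Fin (m+1) → V →ₗ[ℝ] ℝ) (ε : SignType)
    (σ : Fin m → SignType) :
    flatSub W a (Fin.cons ε σ : Fin (m+1) → SignType) =
      flatSub (cutSub W (a 0) ε) (fun i => a i.succ) σ := by
  ext x
  change (x ∈ W ∧ ∀ i, _) ↔ (x ∈ cutSub W (a 0) ε ∧ ∀ i, _)
  rw [Fin.forall_fin_succ]
  by_cases h : ε = 0 <;> simp [cutSub, h, and_assoc]

lemma cell_cons {m : ℕ} (X : Set V) (a : Fin (m+1) → V →ₗ[ℝ] ℝ) (ε : SignType)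
    (σ : Fin m → SignType) :
    cellSet X a (Fin.cons ε σ : Fin (m+1) → SignType) =
      cellSet (cutSet X (a 0) ε) (fun i => a i.succ) σ := by
  ext x
  simp [cellSet, cutSet, Fin.forall_fin_succ, and_assoc]

lemma eul_succ {m : ℕ} (X : Set V) (W : Submodule ℝ V) (a : Fin (m+1) → V →ₗ[ℝ] ℝ) :
    eul X W a = ∑ ε : SignType, eul (cutSet X (a 0) ε) (cutSub W (a 0) ε) (fun i => a i.succ) := by
  unfold eul
  rw [← Fintype.sum_prod_type']
  symm
  refine Fintype.sum_equiv (Fin.consEquiv (fun _ => SignType)) _ _ ?_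
  rintro ⟨ε, σ⟩
  classical
  change _ = if (cellSet X a (Fin.cons ε σ : Fin (m+1) → SignType)).Nonempty then
    (-1 : ℤ) ^ Module.finrank ℝ (flatSub W a (Fin.cons ε σ : Fin (m+1) → SignType)) else 0
  rw [flat_cons]
  simp only [cell_cons]

lemma eul_empty {m : ℕ} (W : Submodule ℝ V) (a : Fin m → V →ₗ[ℝ] ℝ) : eul ∅ W a = 0 := by
  simp [eul, cellSet]

def RelOpen (X : Set V) (W : Submodule ℝ V) : Prop :=
  Convex ℝ X ∧ X ⊆ W ∧ ∀ x ∈ X, ∀ w ∈ W, ∀ᶠ t in 𝓝 (0:ℝ), x + t • w ∈ X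

lemma ev_pos (p q : ℝ) (hp : 0 < p) : ∀ᶠ t in 𝓝 (0:ℝ), 0 < p + t * q := by
  have : Tendsto (fun t : ℝ => p + t * q) (𝓝 0) (𝓝 (p + 0 * q)) :=
    (Continuous.tendsto (by fun_prop) 0)
  exact this.eventually_const_lt (by simpa using hp)

lemma RelOpen.cut {X : Set V} {W : Submodule ℝ V} (h : RelOpen X W) (b : V →ₗ[ℝ] ℝ)
    (ε : SignType) : RelOpen (cutSet X b ε) (cutSub W b ε) := by
  obtain ⟨hc, hs, ho⟩ := h
  have hcs : ∀ ε, Convex ℝ (cutSet X b ε) := by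
    intro ε x hx y hy s t hs0 ht0 hst
    refine ⟨hc hx.1 hy.1 hs0 ht0 hst, ?_⟩
    have h1 := hx.2
    have h2 := hy.2
    rw [map_add, map_smul, map_smul, smul_eq_mul, smul_eq_mul]
    have hss : 0 < s ∨ 0 < t := by
      by_contra! hh
      linarith
    rcases ε with _ | _ | _
    · have h1 := sign_eq_zero_iff.1 h1
      have h2 := sign_eq_zero_iff.1 h2
      simp [h1, h2]
    · have h1 := sign_eq_neg_one_iff.1 h1
      have h2 := sign_eq_neg_one_iff.1 h2
      refine sign_eq_neg_one_iff.2 ?_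
      rcases hss with hh | hh <;> nlinarith
    · have h1 := sign_eq_one_iff.1 h1
      have h2 := sign_eq_one_iff.1 h2
      refine sign_eq_one_iff.2 ?_
      rcases hss with hh | hh <;> nlinarith
  refine ⟨hcs ε, ?_, ?_⟩
  · rintro x ⟨hx, hx'⟩
    have := hs hx
    by_cases h : ε = 0
    · subst h
      simpa [cutSub] using ⟨this, sign_eq_zero_iff.1 hx'⟩
    · simpa [cutSub, h] using this
  · rintro x ⟨hx, hx'⟩ w hw
    rcases ε with _ | _ | _
    · have hw : w ∈ W ⊓ LinearMap.ker b := hw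
      filter_upwards [ho x hx w hw.1] with t ht
      refine ⟨ht, ?_⟩
      have : b w = 0 := hw.2
      simpa [this] using hx'
    · have hw : w ∈ W := hw
      have h1 := sign_eq_neg_one_iff.1 hx'
      filter_upwards [ho x hx w hw, ev_pos (-b x) (-b w) (by linarith)] with t ht ht'
      refine ⟨ht, sign_eq_neg_one_iff.2 ?_⟩
      simp only [map_add, map_smul, smul_eq_mul]
      linarith
    · have hw : w ∈ W := hw
      have h1 := sign_eq_one_iff.1 hx'
      filter_upwards [ho x hx w hw, ev_pos (b x) (b w) (by linarith)] with t ht ht'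
      refine ⟨ht, sign_eq_one_iff.2 ?_⟩
      simp only [map_add, map_smul, smul_eq_mul]
      linarith

lemma finrank_ker_cut [FiniteDimensional ℝ V] (W : Submodule ℝ V) (b : V →ₗ[ℝ] ℝ)
    (w : V) (hw : w ∈ W) (hb : b w ≠ 0) :
    Module.finrank ℝ W = Module.finrank ℝ (W ⊓ LinearMap.ker b : Submodule ℝ V) + 1 := by
  have h := LinearMap.finrank_range_add_finrank_ker (b.domRestrict W)
  have h1 : LinearMap.range (b.domRestrict W) = ⊤ := by
    apply LinearMap.range_eq_top.2
    apply LinearMap.surjective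
    intro h0
    exact hb (LinearMap.congr_fun h0 ⟨w, hw⟩)
  have h2 : (LinearMap.ker (b.domRestrict W)).map W.subtype = W ⊓ LinearMap.ker b := by
    ext x
    simp [and_comm]
  have h3 := LinearEquiv.finrank_eq
    (Submodule.equivMapOfInjective W.subtype W.injective_subtype (LinearMap.ker (b.domRestrict W)))
  rw [h2] at h3
  rw [h1, finrank_top, Module.finrank_self] at h
  omega

lemma eul_eq [FiniteDimensional ℝ V] {m : ℕ} (X : Set V) (W : Submodule ℝ V)
    (a : Fin m → V →ₗ[ℝ] ℝ) (h : RelOpen X W) (hne : X.Nonempty) :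
    eul X W a = (-1) ^ Module.finrank ℝ W := by
  induction m generalizing X W with
  | zero =>
    have h1 : ∀ σ, cellSet X a σ = X := by intro σ; ext x; simp [cellSet]
    have h2 : ∀ σ, flatSub W a σ = W := by
      intro σ; ext x; change (x ∈ W ∧ ∀ i, _) ↔ _; simp
    unfold eul
    rw [Fintype.sum_unique, h2, if_pos (by rw [h1]; exact hne)]
  | succ m ih =>
    rw [eul_succ]
    set b := a 0
    have key : ∀ ε, (cutSet X b ε).Nonempty → eul (cutSet X b ε) (cutSub W b ε)
        (fun i => a i.succ) = (-1) ^ Module.finrank ℝ (cutSub W b ε) :=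
      fun ε hε => ih _ _ _ (h.cut b ε) hε
    have key0 : ∀ ε, ¬ (cutSet X b ε).Nonempty → eul (cutSet X b ε) (cutSub W b ε)
        (fun i => a i.succ) = 0 := by
      intro ε hε
      rw [Set.not_nonempty_iff_eq_empty.1 hε, eul_empty]
    have hsum : ∀ f : SignType → ℤ, ∑ ε, f ε = f 0 + f (-1) + f 1 := by
      intro f
      have : (Finset.univ : Finset SignType) = {0, -1, 1} := by decide
      rw [this]
      simp [add_assoc]
    rw [hsum]
    obtain ⟨hc, hs, ho⟩ := h
    have e0 : cutSub W b 0 = W ⊓ LinearMap.ker b := rfl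
    have e1 : cutSub W b 1 = W := rfl
    have e2 : cutSub W b (-1) = W := rfl
    by_cases hW : ∃ w ∈ W, b w ≠ 0
    · obtain ⟨w, hw, hbw⟩ := hW
      have hfr := finrank_ker_cut W b w hw hbw
      by_cases hz : (cutSet X b 0).Nonempty
      · obtain ⟨x, hx, hx0⟩ := id hz
        have hx0 := sign_eq_zero_iff.1 hx0
        have hp : ∀ v ∈ W, 0 < b v → ∃ y ∈ X, 0 < b y := by
          intro v hv hbv
          obtain ⟨t, ht, htp⟩ := ((ho x hx v hv).filter_mono nhdsWithin_le_nhds |>.and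
            (self_mem_nhdsWithin : Set.Ioi (0:ℝ) ∈ 𝓝[>] 0)).exists
          exact ⟨_, ht, by simpa [hx0] using mul_pos htp hbv⟩
        have hn : ∀ v ∈ W, b v < 0 → ∃ y ∈ X, b y < 0 := by
          intro v hv hbv
          obtain ⟨t, ht, htp⟩ := ((ho x hx v hv).filter_mono nhdsWithin_le_nhds |>.and
            (self_mem_nhdsWithin : Set.Ioi (0:ℝ) ∈ 𝓝[>] 0)).exists
          exact ⟨_, ht, by simpa [hx0] using mul_neg_of_pos_of_neg htp hbv⟩
        have hP : (cutSet X b 1).Nonempty := by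
          obtain ⟨y, hy, hy'⟩ : ∃ y ∈ X, 0 < b y := by
            rcases lt_or_gt_of_ne hbw with h | h
            · exact hp (-w) (W.neg_mem hw) (by simpa using h)
            · exact hp w hw h
          exact ⟨y, hy, sign_eq_one_iff.2 hy'⟩
        have hN : (cutSet X b (-1)).Nonempty := by
          obtain ⟨y, hy, hy'⟩ : ∃ y ∈ X, b y < 0 := by
            rcases lt_or_gt_of_ne hbw with h | h
            · exact hn w hw h
            · exact hn (-w) (W.neg_mem hw) (by simpa using h)
          exact ⟨y, hy, sign_eq_neg_one_iff.2 hy'⟩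
        rw [key 0 hz, key 1 hP, key (-1) hN, e0, e1, e2, hfr, pow_succ]
        ring
      · by_cases hP : (cutSet X b 1).Nonempty
        · have hN : ¬ (cutSet X b (-1)).Nonempty := by
            rintro ⟨y, hy, hyn⟩
            obtain ⟨z, hz', hzp⟩ := hP
            have hyn := sign_eq_neg_one_iff.1 hyn
            have hzp := sign_eq_one_iff.1 hzp
            apply hz
            have hd : 0 < b z - b y := by linarith
            refine ⟨(b z / (b z - b y)) • y + (-b y / (b z - b y)) • z,
              hc hy hz' (by positivity) (div_nonneg (by linarith) hd.le) (by field_simp; ring), ?_⟩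
            apply sign_eq_zero_iff.2
            simp only [map_add, map_smul, smul_eq_mul]
            field_simp
            ring
          rw [key0 0 hz, key 1 hP, key0 (-1) hN, e1]
          ring
        · have hN : (cutSet X b (-1)).Nonempty := by
            obtain ⟨x, hx⟩ := hne
            refine ⟨x, hx, ?_⟩
            rcases hsx : SignType.sign (b x) with _ | _ | _
            · exact absurd ⟨x, hx, hsx⟩ hz
            · rfl
            · exact absurd ⟨x, hx, hsx⟩ hP
          rw [key0 0 hz, key0 1 hP, key (-1) hN, e2]
          ring
    · push Not at hW
      have hz : (cutSet X b 0).Nonempty := by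
        obtain ⟨x, hx⟩ := hne
        exact ⟨x, hx, sign_eq_zero_iff.2 (hW x (hs hx))⟩
      have hP : ¬ (cutSet X b 1).Nonempty := by
        rintro ⟨x, hx, hx'⟩
        have := sign_eq_one_iff.1 hx'
        rw [hW x (hs hx)] at this
        exact lt_irrefl _ this
      have hN : ¬ (cutSet X b (-1)).Nonempty := by
        rintro ⟨x, hx, hx'⟩
        have := sign_eq_neg_one_iff.1 hx'
        rw [hW x (hs hx)] at this
        exact lt_irrefl _ this
      have e3 : W ⊓ LinearMap.ker b = W := inf_eq_left.2 hW
      rw [key 0 hz, key0 1 hP, key0 (-1) hN, e0, e3]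
      ring

open Classical in
lemma cone_sum [FiniteDimensional ℝ V] {m : ℕ} (hm : 0 < m)
    (a : Fin m → V →ₗ[ℝ] ℝ) (x₀ : V) (hx₀ : ∀ i, 0 < a i x₀) :
    ∑ σ : Fin m → SignType, (if (∀ i, σ i ≠ -1) ∧ (cellSet Set.univ a σ).Nonempty then
      (-1 : ℤ) ^ Module.finrank ℝ (flatSub ⊤ a σ) else 0) = 0 := by
  have hJ : ∀ J : Finset (Fin m),
      eul {x | ∀ i ∈ J, a i x < 0} ⊤ a = (-1) ^ Module.finrank ℝ V := by
    intro J
    rw [eul_eq, finrank_top]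
    · refine ⟨?_, by simp, ?_⟩
      · intro x hx y hy s t hs ht hst i hi
        have h1 := hx i hi
        have h2 := hy i hi
        simp only [map_add, map_smul, smul_eq_mul]
        have hss : 0 < s ∨ 0 < t := by
          by_contra! hh
          linarith
        rcases hss with hh | hh <;> nlinarith
      · intro x hx w _
        simp only [Set.mem_ofPred_eq]
        rw [Filter.eventually_all_finset]
        intro i hi
        have h1 := hx i hi
        filter_upwards [ev_pos (-a i x) (-a i w) (by linarith)] with t ht
        simp only [map_add, map_smul, smul_eq_mul]
        linarith
    · exact ⟨-x₀, fun i _ => by simpa using hx₀ i⟩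
  have hcell : ∀ (J : Finset (Fin m)) (σ : Fin m → SignType),
      (cellSet {x | ∀ i ∈ J, a i x < 0} a σ).Nonempty ↔
        (∀ i ∈ J, σ i = -1) ∧ (cellSet Set.univ a σ).Nonempty := by
    intro J σ
    constructor
    · rintro ⟨x, hx, hx'⟩
      exact ⟨fun i hi => by rw [← hx' i]; exact sign_eq_neg_one_iff.2 (hx i hi), x, trivial, hx'⟩
    · rintro ⟨h, x, -, hx⟩
      exact ⟨x, fun i hi => sign_eq_neg_one_iff.1 (by rw [hx i, h i hi]), hx⟩
  have hie : ∀ σ : Fin m → SignType, (if ∀ i, σ i ≠ -1 then (1:ℤ) else 0) =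
      ∑ J : Finset (Fin m), (-1) ^ J.card * (if ∀ i ∈ J, σ i = -1 then (1:ℤ) else 0) := by
    intro σ
    have h1 : (if ∀ i, σ i ≠ -1 then (1:ℤ) else 0) =
        ∏ i, (1 - if σ i = -1 then (1:ℤ) else 0) := by
      split_ifs with h
      · symm
        apply Finset.prod_eq_one
        intro i _
        simp [h i]
      · push Not at h
        obtain ⟨i, hi⟩ := h
        symm
        exact Finset.prod_eq_zero (Finset.mem_univ i) (by simp [hi])
    simp only [h1, sub_eq_add_neg]
    rw [Finset.prod_one_add, Finset.powerset_univ]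
    refine Finset.sum_congr rfl fun J _ => ?_
    rw [Finset.prod_neg, Finset.prod_ite_zero]
    simp
  have h0 : ∑ J : Finset (Fin m), (-1 : ℤ) ^ J.card = 0 := by
    have := Finset.sum_powerset_neg_one_pow_card_of_nonempty
      (x := (Finset.univ : Finset (Fin m))) ⟨⟨0, hm⟩, Finset.mem_univ _⟩
    rwa [Finset.powerset_univ] at this
  calc _ = ∑ σ : Fin m → SignType, ∑ J : Finset (Fin m), (-1) ^ J.card *
        (if (cellSet {x | ∀ i ∈ J, a i x < 0} a σ).Nonempty then
          (-1 : ℤ) ^ Module.finrank ℝ (flatSub ⊤ a σ) else 0) := by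
        refine Finset.sum_congr rfl fun σ _ => ?_
        by_cases hne : (cellSet Set.univ a σ).Nonempty
        · simp only [hcell, hne, and_true]
          rw [← boole_mul, hie σ, Finset.sum_mul]
          refine Finset.sum_congr rfl fun J _ => ?_
          rw [mul_assoc, boole_mul]
        · simp [hcell, hne]
    _ = ∑ J : Finset (Fin m), (-1) ^ J.card * eul {x | ∀ i ∈ J, a i x < 0} ⊤ a := by
        rw [Finset.sum_comm]
        simp only [eul, Finset.mul_sum]
    _ = 0 := by
        simp only [hJ]
        rw [← Finset.sum_mul, h0, zero_mul]

end Arr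

section Poly

/-- The affine constraint `(y, c) ↦ c - ⟪p, y⟫` attached to a point `p`. -/
def cons1 {n : ℕ} (p : Euc n) : (Euc n × ℝ) →ₗ[ℝ] ℝ :=
  LinearMap.snd ℝ (Euc n) ℝ - (innerₗ (Euc n) p) ∘ₗ LinearMap.fst ℝ (Euc n) ℝ

lemma cons1_apply {n : ℕ} (p : Euc n) (z : Euc n × ℝ) : cons1 p z = z.2 - inner ℝ p z.1 := rfl

open Classical in
/-- The sign vector of a face. -/
def faceSign {n m : ℕ} (s : Fin m → Euc n) (F : Set (Euc n)) : Fin m → SignType :=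
  fun i => if s i ∈ F then 0 else 1

lemma face_hull {n m : ℕ} (s : Fin m → Euc n) (F : Set (Euc n))
    (hF : IsExposed ℝ (convexHull ℝ (Set.range s)) F) :
    F = convexHull ℝ (Set.image s {i | s i ∈ F}) := by
  have hPc : IsCompact (convexHull ℝ (Set.range s)) := (Set.finite_range s).isCompact_convexHull ℝ
  have hFc : IsCompact F := hF.isCompact hPc
  have hFv : Convex ℝ F := hF.convex (convex_convexHull ℝ _)
  apply Set.Subset.antisymm
  · have h1 : F.extremePoints ℝ ⊆ Set.image s {i | s i ∈ F} := by
      intro x hx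
      have hx2 := hF.isExtreme.extremePoints_subset_extremePoints hx
      obtain ⟨i, rfl⟩ := extremePoints_convexHull_subset hx2
      exact ⟨i, hx.1, rfl⟩
    have h2 := closure_convexHull_extremePoints hFc hFv
    have h3 : IsClosed (convexHull ℝ (Set.image s {i | s i ∈ F})) :=
      ((Set.toFinite (Set.image s {i | s i ∈ F})).isCompact_convexHull ℝ).isClosed
    calc F = closure (convexHull ℝ (F.extremePoints ℝ)) := h2.symm
      _ ⊆ _ := closure_minimal (convexHull_mono h1) h3
  · apply convexHull_min _ hFv
    rintro _ ⟨i, hi, rfl⟩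
    exact hi

lemma le_on_hull {n m : ℕ} (s : Fin m → Euc n) (y : Euc n) (c : ℝ)
    (h : ∀ i, inner ℝ (s i) y ≤ c) : ∀ x ∈ convexHull ℝ (Set.range s), inner ℝ x y ≤ c := by
  have hc : Convex ℝ {x : Euc n | inner ℝ x y ≤ c} := by
    have := convex_halfSpace_le (𝕜 := ℝ) (f := fun x : Euc n => inner ℝ x y)
      ⟨fun a b => inner_add_left _ _ _, fun a b => real_inner_smul_left _ _ _⟩ c
    exact this
  intro x hx
  refine convexHull_min ?_ hc hx
  rintro _ ⟨i, rfl⟩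
  exact h i

/-- A realized nonnegative sign vector with a zero comes from a face. -/
lemma face_of_sign {n m : ℕ} (s : Fin m → Euc n) (σ : Fin m → SignType)
    (h1 : ∀ i, σ i ≠ -1) (h2 : (cellSet Set.univ (fun i => cons1 (s i)) σ).Nonempty)
    (h3 : ∃ i, σ i = 0) :
    ∃ F, IsExposed ℝ (convexHull ℝ (Set.range s)) F ∧ F.Nonempty ∧ faceSign s F = σ := by
  obtain ⟨⟨y, c⟩, -, hz⟩ := h2
  obtain ⟨i₀, hi₀⟩ := h3
  simp only [cons1_apply] at hz
  have hle : ∀ i, inner ℝ (s i) y ≤ c := by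
    intro i
    by_contra! hlt
    exact h1 i (by rw [← hz i]; exact sign_eq_neg_one_iff.2 (by linarith))
  have heq : ∀ i, σ i = 0 ↔ inner ℝ (s i) y = c := by
    intro i
    rw [← hz i, sign_eq_zero_iff, sub_eq_zero, eq_comm]
  have hP := le_on_hull s y c hle
  have hm : ∀ i, s i ∈ convexHull ℝ (Set.range s) := fun i => subset_convexHull _ _ ⟨i, rfl⟩
  have hi₀' := (heq i₀).1 hi₀
  refine ⟨{x ∈ convexHull ℝ (Set.range s) | inner ℝ x y = c}, ?_, ⟨s i₀, hm i₀, hi₀'⟩, ?_⟩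
  · intro _
    refine ⟨InnerProductSpace.toDual ℝ (Euc n) y, ?_⟩
    ext x
    simp only [Set.mem_ofPred_eq, InnerProductSpace.toDual_apply_apply]
    refine and_congr_right fun hx => ⟨fun h z hz => ?_, fun h => ?_⟩
    · rw [real_inner_comm, real_inner_comm x, h]
      exact hP z hz
    · have := h _ (hm i₀)
      rw [real_inner_comm, hi₀', real_inner_comm] at this
      exact le_antisymm (hP x hx) this
  · funext i
    unfold faceSign
    split_ifs with h
    · exact ((heq i).2 h.2).symm
    · have h0 : σ i ≠ 0 := fun h0 => h ⟨hm i, (heq i).1 h0⟩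
      have h1 := h1 i
      revert h0 h1
      generalize σ i = e
      revert e
      decide

lemma sign_of_face {n m : ℕ} (s : Fin m → Euc n) (F : Set (Euc n))
    (hF : IsExposed ℝ (convexHull ℝ (Set.range s)) F) (hne : F.Nonempty) :
    (∀ i, faceSign s F i ≠ -1) ∧
      (cellSet Set.univ (fun i => cons1 (s i)) (faceSign s F)).Nonempty ∧
      (∃ i, faceSign s F i = 0) := by
  refine ⟨?_, ?_, ?_⟩
  · intro i
    unfold faceSign
    split_ifs <;> decide
  · obtain ⟨l, hl⟩ := hF hne
    obtain ⟨x, hx⟩ := hne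
    set y := (InnerProductSpace.toDual ℝ (Euc n)).symm l with hy
    have hly : ∀ z, inner ℝ z y = l z := by
      intro z
      rw [real_inner_comm, hy, InnerProductSpace.toDual_symm_apply]
    have hm : ∀ i, s i ∈ convexHull ℝ (Set.range s) := fun i => subset_convexHull _ _ ⟨i, rfl⟩
    have hx' := hx
    rw [hl] at hx'
    refine ⟨(y, l x), trivial, fun i => ?_⟩
    simp only [cons1_apply, hly]
    unfold faceSign
    split_ifs with h
    · rw [hl] at h
      rw [sign_eq_zero_iff]
      have := h.2 x hx'.1
      have := hx'.2 _ (hm i)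
      linarith
    · rw [sign_eq_one_iff, sub_pos]
      by_contra! hlt
      apply h
      rw [hl]
      exact ⟨hm i, fun z hz => (hx'.2 z hz).trans hlt⟩
  · have h := face_hull s F hF
    rw [h] at hne
    obtain ⟨_, i, hi, rfl⟩ := convexHull_nonempty_iff.1 hne
    exact ⟨i, if_pos hi⟩

lemma faceSign_inj {n m : ℕ} (s : Fin m → Euc n) (F G : Set (Euc n))
    (hF : IsExposed ℝ (convexHull ℝ (Set.range s)) F)
    (hG : IsExposed ℝ (convexHull ℝ (Set.range s)) G)
    (h : faceSign s F = faceSign s G) : F = G := by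
  rw [face_hull s F hF, face_hull s G hG]
  congr 2
  ext i
  have := congrFun h i
  unfold faceSign at this
  simp only [Set.mem_ofPred_eq]
  split_ifs at this <;> simp_all

lemma finrank_flat {n m : ℕ} (s : Fin m → Euc n) (F : Set (Euc n))
    (hF : IsExposed ℝ (convexHull ℝ (Set.range s)) F) (hne : F.Nonempty) :
    Module.finrank ℝ (flatSub ⊤ (fun i => cons1 (s i)) (faceSign s F)) + faceDim F = n := by
  obtain ⟨-, -, i₀, hi₀⟩ := sign_of_face s F hF hne
  have hz : ∀ i, faceSign s F i = 0 ↔ s i ∈ F := by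
    intro i
    unfold faceSign
    split_ifs with h <;> simp [h]
  have hi₀' := (hz i₀).1 hi₀
  have hD : (affineSpan ℝ F).direction =
      Submodule.span ℝ (Set.image (fun x => x - s i₀) (Set.image s {i | s i ∈ F})) := by
    have h := face_hull s F hF
    have h' : affineSpan ℝ F = affineSpan ℝ (Set.image s {i | s i ∈ F}) := by
      conv_lhs => rw [h]
      exact affineSpan_convexHull _
    rw [h', direction_affineSpan,
      vectorSpan_eq_span_vsub_set_right ℝ (Set.mem_image_of_mem s (show i₀ ∈ {i | s i ∈ F} from hi₀'))]
    rfl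
  let φ : Euc n →ₗ[ℝ] (Euc n × ℝ) := LinearMap.prod LinearMap.id (innerₗ (Euc n) (s i₀))
  have hφ : Function.Injective φ := fun x y h => congrArg Prod.fst h
  have hmap : ((affineSpan ℝ F).direction)ᗮ.map φ =
      flatSub ⊤ (fun i => cons1 (s i)) (faceSign s F) := by
    ext ⟨y, c⟩
    change _ ↔ ((y, c) ∈ (⊤ : Submodule ℝ (Euc n × ℝ)) ∧
      ∀ i, faceSign s F i = 0 → cons1 (s i) (y, c) = 0)
    simp only [Submodule.mem_top, true_and, cons1_apply, hz]
    rw [hD]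
    constructor
    · rintro ⟨x, hx, hxy⟩
      obtain ⟨rfl, rfl⟩ := Prod.mk.inj hxy
      intro i hi
      have := hx (s i - s i₀) (Submodule.subset_span (Set.mem_image_of_mem _ (Set.mem_image_of_mem s hi)))
      rw [inner_sub_left] at this
      change inner ℝ (s i₀) x - inner ℝ (s i) x = 0
      linarith
    · intro h
      refine ⟨y, ?_, ?_⟩
      · rw [SetLike.mem_coe, Submodule.mem_orthogonal]
        intro u hu
        induction hu using Submodule.span_induction with
        | mem u hu =>
          obtain ⟨_, ⟨i, hi, rfl⟩, rfl⟩ := hu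
          have h1 := h i hi
          have h2 := h i₀ hi₀'
          simp only [inner_sub_left]
          linarith
        | zero => simp
        | add u v _ _ hu hv => rw [inner_add_left, hu, hv, add_zero]
        | smul t u _ hu => rw [inner_smul_left, hu, mul_zero]
      · refine Prod.ext rfl ?_
        change inner ℝ (s i₀) y = c
        have h2 := h i₀ hi₀'
        linarith
  have h3 := LinearEquiv.finrank_eq
    (Submodule.equivMapOfInjective φ hφ ((affineSpan ℝ F).direction)ᗮ)
  rw [hmap] at h3
  have h4 := Submodule.finrank_add_finrank_orthogonal (affineSpan ℝ F).direction
  rw [finrank_euclideanSpace_fin] at h4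
  unfold faceDim
  omega

end Poly

/-- Euler relation: for an `n`-dimensional compact convex polytope
`P ⊆ ℝⁿ` with `f_j` faces of dimension `j`, one has `∑_{j=0}^{n} (−1)^j f_j = 1`. -/
theorem euler_relation {n : ℕ} (P : Set (Euc n))
    (hP : IsPolytope P) (hfull : (interior P).Nonempty)
    (Fs : ℕ → Finset (Set (Euc n)))
    (hFs : ∀ j F, F ∈ Fs j ↔ IsFaceDim P F j) :
    ∑ j ∈ Finset.range (n + 1), (-1 : ℤ) ^ j * (Fs j).card = 1 := by
  classical
  obtain ⟨S, hS, rfl⟩ := hP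
  obtain ⟨m, s, hs⟩ : ∃ (m : ℕ) (s : Fin m → Euc n), Set.range s = (S : Set (Euc n)) :=
    ⟨S.card, fun i => (S.equivFin.symm i : Euc n), by
      ext x
      constructor
      · rintro ⟨i, rfl⟩
        exact (S.equivFin.symm i).2
      · intro hx
        exact ⟨S.equivFin ⟨x, hx⟩, by simp⟩⟩
  have hm : 0 < m := by
    obtain ⟨x, hx⟩ := hS
    have : x ∈ Set.range s := by rw [hs]; exact hx
    obtain ⟨i, -⟩ := this
    exact i.pos
  rw [← hs] at hFs
  have hcone := cone_sum hm (fun i => cons1 (s i)) ((0 : Euc n), (1 : ℝ))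
    (fun i => by simp [cons1_apply])
  set a := fun i => cons1 (s i) with ha
  have hsplit : ∀ σ : Fin m → SignType,
      (if (∀ i, σ i ≠ -1) ∧ (cellSet Set.univ a σ).Nonempty then
        (-1 : ℤ) ^ Module.finrank ℝ (flatSub ⊤ a σ) else 0) =
      (if (∀ i, σ i ≠ -1) ∧ (cellSet Set.univ a σ).Nonempty ∧ (∃ i, σ i = 0) then
        (-1 : ℤ) ^ Module.finrank ℝ (flatSub ⊤ a σ) else 0) +
      (if σ = (fun _ => 1) then (-1 : ℤ) ^ (n + 1) else 0) := by
    intro σ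
    by_cases h : σ = (fun _ => 1)
    · subst h
      have h1 : (cellSet Set.univ a (fun _ => 1)).Nonempty :=
        ⟨((0 : Euc n), (1 : ℝ)), trivial, fun i => by simp [ha, cons1_apply]⟩
      have h2 : flatSub ⊤ a (fun _ => 1) = ⊤ := by
        rw [eq_top_iff]
        intro x _
        exact ⟨trivial, fun i hi => absurd hi one_ne_zero⟩
      have h3 : ∀ i : Fin m, (fun _ : Fin m => (1 : SignType)) i ≠ -1 := fun _ => (by decide : (1 : SignType) ≠ -1)
      have h4 : ¬ ∃ i : Fin m, (fun _ : Fin m => (1 : SignType)) i = 0 := by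
        rintro ⟨i, hi⟩
        exact absurd hi one_ne_zero
      rw [if_pos ⟨h3, h1⟩, if_neg (fun h => h4 h.2.2), if_pos rfl, h2, finrank_top]
      simp
    · rw [if_neg h, add_zero]
      refine if_congr ⟨fun hh => ⟨hh.1, hh.2, ?_⟩, fun hh => ⟨hh.1, hh.2.1⟩⟩ rfl rfl
      by_contra! h0
      apply h
      funext i
      have h1 := hh.1 i
      have h0 := h0 i
      revert h0 h1
      generalize σ i = e
      revert e
      decide
  rw [Finset.sum_congr rfl (fun σ _ => hsplit σ), Finset.sum_add_distrib,
    Finset.sum_ite_eq' Finset.univ, if_pos (Finset.mem_univ _), ← Finset.sum_filter] at hcone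
  have hmain : ∑ j ∈ Finset.range (n + 1), (-1 : ℤ) ^ j * (Fs j).card =
      ∑ σ with (∀ i, σ i ≠ -1) ∧ (cellSet Set.univ a σ).Nonempty ∧ (∃ i, σ i = 0),
        (-1 : ℤ) ^ n * (-1 : ℤ) ^ Module.finrank ℝ (flatSub ⊤ a σ) := by
    calc _ = ∑ p ∈ (Finset.range (n + 1)).sigma Fs, (-1 : ℤ) ^ p.1 := by
          rw [Finset.sum_sigma]
          refine Finset.sum_congr rfl fun j _ => ?_
          simp [mul_comm]
      _ = _ := by
          refine Finset.sum_bij (fun p _ => faceSign s p.2) ?_ ?_ ?_ ?_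
          · rintro ⟨j, F⟩ hp
            obtain ⟨h1, h2, -⟩ := (hFs j F).1 (Finset.mem_sigma.1 hp).2
            exact Finset.mem_filter.2 ⟨Finset.mem_univ _, sign_of_face s F h1 h2⟩
          · rintro ⟨j, F⟩ hp ⟨k, G⟩ hq h
            obtain ⟨h1, h2, h3⟩ := (hFs j F).1 (Finset.mem_sigma.1 hp).2
            obtain ⟨g1, g2, g3⟩ := (hFs k G).1 (Finset.mem_sigma.1 hq).2
            have hFG := faceSign_inj s F G h1 g1 h
            subst hFG
            subst h3
            subst g3
            rfl
          · intro σ hσ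
            obtain ⟨-, h1, h2, h3⟩ := Finset.mem_filter.1 hσ
            obtain ⟨F, hF, hne, hFσ⟩ := face_of_sign s σ h1 h2 h3
            refine ⟨⟨faceDim F, F⟩, Finset.mem_sigma.2 ⟨?_, (hFs _ F).2 ⟨hF, hne, rfl⟩⟩, hFσ⟩
            have := finrank_flat s F hF hne
            rw [Finset.mem_range]
            dsimp only
            omega
          · rintro ⟨j, F⟩ hp
            obtain ⟨h1, h2, h3⟩ := (hFs j F).1 (Finset.mem_sigma.1 hp).2
            have h4 := finrank_flat s F h1 h2
            rw [h3] at h4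
            change (-1 : ℤ) ^ j = (-1) ^ n * (-1) ^ Module.finrank ℝ (flatSub ⊤ a (faceSign s F))
            rw [← pow_add]
            generalize Module.finrank ℝ (flatSub ⊤ a (faceSign s F)) = d at h4 ⊢
            have h5 : n + d = j + 2 * d := by omega
            rw [h5, pow_add, pow_mul]
            simp
  rw [hmain, ← Finset.mul_sum, eq_neg_of_add_eq_zero_left hcone, pow_succ, mul_neg, mul_neg_one,
    mul_neg, neg_neg, ← mul_pow]
  simp
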